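/- arXiv:1701.02573 — 2 statements merged into one kernel-verified Lean document; each statement's English description precedes it below -/
import Mathlib

section
/- Let R be a Noetherian commutative ring, W ∈ R a non-zero-divisor, and m a maximal ideal of R with W ∈ m. Then the following are equivalent: (i) there exists a finitely generated R/(W)-module M such that M has finite projective dimension as an R-module and the localization M_m has infinite projective dimension over (R/(W))_m; (ii) there exists a finitely generated (R/(W))_m-module N with infinite projective dimension over (R/(W))_m and finite projective dimension over R_m. -/
open CategoryTheory

/-- A module `M` over a ring `A` has finite projective dimension iff it admits a
projective resolution which vanishes in all sufficiently large degrees. -/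
def HasFinProjDim (A : Type) [Ring A] (M : Type) [AddCommGroup M] [Module A M] : Prop :=
  ∃ (P : ProjectiveResolution (ModuleCat.of A M)) (n : ℕ),
    ∀ m : ℕ, n < m → Limits.IsZero (P.complex.X m)

/-- The image in `R/(W)` of the complement of a prime `m` of `R`; localizing `R/(W)`
at this submonoid gives the localization of `R/(W)` at the prime `m/(W)`. -/
abbrev imageSubmonoid (R : Type) [CommRing R] (W : R) (m : Ideal R) [m.IsPrime] :
    Submonoid (R ⧸ Ideal.span {W}) :=
  Submonoid.map (Ideal.Quotient.mk (Ideal.span {W})) m.primeCompl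

/-- The canonical ring homomorphism `R_m → (R/(W))_m` induced by `R → R/(W)`. -/
noncomputable def locQuotMap (R : Type) [CommRing R] (W : R) (m : Ideal R) [m.IsPrime] :
    Localization.AtPrime m →+* Localization (imageSubmonoid R W m) :=
  IsLocalization.map _ (Ideal.Quotient.mk (Ideal.span {W}))
    (Submonoid.le_comap_map m.primeCompl)

open Limits Abelian

namespace CategoryTheory.ProjectiveResolution

universe v u

variable {C : Type u} [Category.{v} C] [Abelian C]

lemma hasProjectiveDimensionLT {X : C} (P : ProjectiveResolution X) (n : ℕ)
    (h : ∀ i, n ≤ i → IsZero (P.complex.X i)) : HasProjectiveDimensionLT X n := by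
  let := HasExt.standard C
  rw [hasProjectiveDimensionLT_iff]
  intro i hi Y e
  obtain ⟨f, hf, rfl⟩ := P.extMk_surjective e (i + 1) rfl
  obtain rfl := (h i hi).eq_of_src f 0
  exact P.extMk_zero (i + 1) rfl

/-- The augmentation of a projective resolution, as a morphism onto the resolved object. -/
noncomputable def augmentation {X : C} (P : ProjectiveResolution X) : P.complex.X 0 ⟶ X := P.π.f 0

instance {X : C} (P : ProjectiveResolution X) : Epi P.augmentation :=
  inferInstanceAs (Epi (P.π.f 0))

lemma d_augmentation {X : C} (P : ProjectiveResolution X) :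
    P.complex.d 1 0 ≫ P.augmentation = 0 :=
  P.complex_d_comp_π_f_zero

lemma exact_augmentation {X : C} (P : ProjectiveResolution X) :
    (ShortComplex.mk _ _ P.d_augmentation).Exact :=
  P.exact₀

/-- A projective resolution of `S.X₃` obtained by splicing a short exact sequence `S` with
projective middle term and a projective resolution of `S.X₁`. -/
noncomputable def splice {S : ShortComplex C} (hS : S.ShortExact) [Projective S.X₂]
    (Q : ProjectiveResolution S.X₁) : ProjectiveResolution S.X₃ where
  complex := ChainComplex.augment Q.complex (Q.augmentation ≫ S.f) (by
    rw [← Category.assoc, d_augmentation, zero_comp])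
  projective n := by
    cases n with
    | zero => exact ‹Projective S.X₂›
    | succ n => exact Q.projective n
  π := (ChainComplex.toSingle₀Equiv _ _).symm ⟨S.g, by
    change (Q.augmentation ≫ S.f) ≫ S.g = 0
    rw [Category.assoc, S.zero, comp_zero]⟩
  quasiIso := ⟨fun n => by
    have := hS.mono_f
    have := hS.epi_g
    match n with
    | 0 =>
      rw [ChainComplex.quasiIsoAt₀_iff, ShortComplex.quasiIso_iff_of_zeros']
      · let φ : ShortComplex.mk (Q.augmentation ≫ S.f) S.g (by simp) ⟶ S :=
          { τ₁ := Q.augmentation, τ₂ := 𝟙 _, τ₃ := 𝟙 _ }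
        have : Epi φ.τ₁ := inferInstanceAs (Epi Q.augmentation)
        have : IsIso φ.τ₂ := inferInstanceAs (IsIso (𝟙 _))
        have : Mono φ.τ₃ := inferInstanceAs (Mono (𝟙 _))
        refine (ShortComplex.exact_and_epi_g_iff_of_iso ?_).mpr
          ⟨(ShortComplex.exact_iff_of_epi_of_isIso_of_mono φ).mpr hS.exact, ‹Epi S.g›⟩
        refine ShortComplex.isoMk (Iso.refl _) (Iso.refl _) (Iso.refl _)
          ((Category.id_comp _).trans (Category.comp_id _).symm) ?_
        refine (Category.id_comp S.g).trans (Eq.symm ?_)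
        refine (Category.comp_id (Y := S.X₃) _).trans ?_
        exact ChainComplex.toSingle₀Equiv_symm_apply_f_zero
          (C := ChainComplex.augment Q.complex (Q.augmentation ≫ S.f) _) (X := S.X₃) S.g _
      all_goals rfl
    | 1 =>
      rw [quasiIsoAt_iff_exactAt' _ _ (ChainComplex.exactAt_succ_single_obj _ _),
        HomologicalComplex.exactAt_iff' _ 2 1 0 (by simp) (by simp)]
      let φ : ShortComplex.mk _ _ Q.d_augmentation ⟶
          ShortComplex.mk (Q.complex.d 1 0) (Q.augmentation ≫ S.f)
            (by rw [← Category.assoc, d_augmentation, zero_comp]) :=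
        { τ₁ := 𝟙 _, τ₂ := 𝟙 _, τ₃ := S.f }
      have : Epi φ.τ₁ := inferInstanceAs (Epi (𝟙 _))
      have : IsIso φ.τ₂ := inferInstanceAs (IsIso (𝟙 _))
      have : Mono φ.τ₃ := inferInstanceAs (Mono S.f)
      exact (ShortComplex.exact_iff_of_epi_of_isIso_of_mono φ).mp Q.exact_augmentation
    | n + 2 =>
      rw [quasiIsoAt_iff_exactAt' _ _ (ChainComplex.exactAt_succ_single_obj _ _),
        HomologicalComplex.exactAt_iff' _ (n + 3) (n + 2) (n + 1) (by simp) (by simp)]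
      exact Q.exact_succ n⟩

lemma exists_isZero_of_hasProjectiveDimensionLE [EnoughProjectives C] (n : ℕ) (X : C)
    [HasProjectiveDimensionLE X n] :
    ∃ P : ProjectiveResolution X, ∀ i, n < i → IsZero (P.complex.X i) := by
  induction n generalizing X with
  | zero =>
    have : Projective X := (projective_iff_hasProjectiveDimensionLE_zero X).mpr ‹_›
    exact ⟨self X, fun i hi ↦ HomologicalComplex.isZero_single_obj_X _ _ _ _ hi.ne'⟩
  | succ n ih =>
    let S := ShortComplex.mk (kernel.ι (Projective.π X)) (Projective.π X) (kernel.condition _)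
    have hS : S.ShortExact := { exact := ShortComplex.exact_kernel _ }
    have hX₂ : Projective S.X₂ := inferInstanceAs (Projective (Projective.over X))
    have : HasProjectiveDimensionLE S.X₁ n := (hS.hasProjectiveDimensionLT_X₃_iff n hX₂).mp ‹_›
    obtain ⟨Q, hQ⟩ := ih S.X₁
    refine ⟨splice hS Q, fun i hi ↦ ?_⟩
    obtain ⟨j, rfl⟩ := Nat.exists_eq_add_one_of_ne_zero (Nat.ne_zero_of_lt hi)
    exact hQ j (by lia)

end CategoryTheory.ProjectiveResolution

lemma hasProjectiveDimensionLT_of_smul_factorization {A : Type} [CommRing A]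
    [IsNoetherianRing A] {x : A} (hx : x ∈ (⊥ : Ideal A).jacobson) {X₁ X₂ X₃ : ModuleCat.{0} A}
    {f : X₁ ⟶ X₂} {g : X₂ ⟶ X₃} {w : f ≫ g = 0} (hS : (ShortComplex.mk f g w).ShortExact)
    [Module.Finite A X₃] (i : X₃ ⟶ X₂) (r : X₂ ⟶ X₃) (hr : i ≫ r = 𝟙 X₃) (hg : i ≫ g = x • 𝟙 X₃)
    (n : ℕ) [HasProjectiveDimensionLT X₁ n] : HasProjectiveDimensionLT X₃ n := by
  refine ModuleCat.hasProjectiveDimensionLT_of_forall_finite _ _ fun L _ ↦ ?_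
  have key : (⊤ : Submodule A (Ext X₃ L n)) ≤ Ideal.span {x} • ⊤ := by
    intro e _
    obtain ⟨e', he'⟩ := Ext.contravariant_sequence_exact₂ hS L ((Ext.mk₀ r).comp e (zero_add n))
      (Ext.eq_zero_of_hasProjectiveDimensionLT _ n le_rfl)
    have h : e = x • e' := by
      have := congrArg (fun t ↦ (Ext.mk₀ i).comp t (zero_add n)) he'
      simpa [hr, hg, Ext.mk₀_smul] using this.symm
    rw [h]
    exact Submodule.smul_mem_smul (Ideal.mem_span_singleton_self x) trivial
  have := Submodule.eq_bot_of_le_smul_of_le_jacobson_bot _ _ Module.Finite.fg_top key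
    ((Ideal.span_singleton_le_iff_mem _).mpr hx)
  exact (Submodule.subsingleton_iff A).mp (subsingleton_of_bot_eq_top this.symm)

lemma hasFinProjDim_iff {A : Type} [Ring A] {M : Type} [AddCommGroup M] [Module A M] :
    HasFinProjDim A M ↔ ∃ n, HasProjectiveDimensionLE (ModuleCat.of A M) n := by
  refine ⟨fun ⟨P, n, hP⟩ ↦ ⟨n, P.hasProjectiveDimensionLT (n + 1) hP⟩, fun ⟨n, _⟩ ↦ ?_⟩
  obtain ⟨P, hP⟩ := ProjectiveResolution.exists_isZero_of_hasProjectiveDimensionLE n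
    (ModuleCat.of A M)
  exact ⟨P, n, hP⟩

section Localization

variable {R : Type} [CommRing R]

lemma hasProjectiveDimensionLE_localizedModule_iff (S : Submonoid R)
    (M : ModuleCat.{0} R) {N : Type} [AddCommGroup N] [Module R N] [Module (Localization S) N]
    [IsScalarTower R (Localization S) N] (f : M →ₗ[R] N) [IsLocalizedModule S f] (n : ℕ) :
    HasProjectiveDimensionLE (M.localizedModule S) n ↔
      HasProjectiveDimensionLE (ModuleCat.of (Localization S) N) n := by
  let e : M.localizedModule S ≃ₗ[Localization S] N :=
    LinearEquiv.extendScalarsOfIsLocalization S (Localization S)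
      (IsLocalizedModule.linearEquiv S (M.localizedModuleMkLinearMap S) f)
  exact ⟨fun _ ↦ ModuleCat.hasProjectiveDimensionLE_of_linearEquiv (N := ModuleCat.of _ N) e n,
    fun _ ↦ ModuleCat.hasProjectiveDimensionLE_of_linearEquiv (M := ModuleCat.of _ N) e.symm n⟩

lemma exists_notMem_forall_hasProjectiveDimensionLE [IsNoetherianRing R] (p : PrimeSpectrum R)
    (M : ModuleCat.{0} R) [Module.Finite R M] (n : ℕ)
    (h : HasProjectiveDimensionLE (M.localizedModule p.asIdeal.primeCompl) n) :
    ∃ s ∉ p.asIdeal, ∀ q : PrimeSpectrum R, s ∉ q.asIdeal →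
      HasProjectiveDimensionLE (M.localizedModule q.asIdeal.primeCompl) n := by
  induction n generalizing M with
  | zero =>
    have key (q : PrimeSpectrum R) : q ∈ Module.freeLocus R M ↔
        HasProjectiveDimensionLE (M.localizedModule q.asIdeal.primeCompl) 0 := by
      rw [Module.mem_freeLocus_of_isLocalization q (Localization q.asIdeal.primeCompl)
        (M.localizedModule q.asIdeal.primeCompl)
        (M.localizedModuleMkLinearMap q.asIdeal.primeCompl),
        ← projective_iff_hasProjectiveDimensionLE_zero, ← IsProjective.iff_projective]
      have := Module.Finite.of_isLocalizedModule q.asIdeal.primeCompl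
        (Rₚ := Localization q.asIdeal.primeCompl)
        (M.localizedModuleMkLinearMap q.asIdeal.primeCompl)
      exact ⟨fun _ ↦ Module.Projective.of_free, fun _ ↦
        Module.free_of_flat_of_isLocalRing (R := Localization.AtPrime q.asIdeal)⟩
    have := Module.finitePresentation_of_finite R M
    obtain ⟨_, ⟨s, rfl⟩, hs, hsub⟩ :=
      PrimeSpectrum.isTopologicalBasis_basic_opens.isOpen_iff.mp
      (Module.isOpen_freeLocus (R := R) (M := M)) p ((key p).mpr h)
    exact ⟨s, hs, fun q hq ↦ (key q).mp (hsub hq)⟩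
  | succ n ih =>
    obtain ⟨P, _, _, _, _, f, hf⟩ := Module.exists_finite_presentation R M
    have hS := LinearMap.shortExact_shortComplexKer hf
    have hP := ModuleCat.projective_of_categoryTheory_projective f.shortComplexKer.X₂
    have key (q : PrimeSpectrum R) :=
      (hS.map_of_exact (ModuleCat.localizedModuleFunctor
        q.asIdeal.primeCompl)).hasProjectiveDimensionLT_X₃_iff n
      ((ModuleCat.localizedModuleFunctor.{0} q.asIdeal.primeCompl).projective_obj_of_projective hP)
    obtain ⟨s, hs, hsq⟩ := ih (ModuleCat.of R (LinearMap.ker f)) ((key p).mp h)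
    exact ⟨s, hs, fun q hq ↦ (key q).mpr (hsq q hq)⟩

end Localization

section ApproximationModule

variable {R : Type} [CommRing R]

lemma hasProjectiveDimensionLE_pi_quotient {W : R} (hW : W ∈ nonZeroDivisors R) (k : ℕ) :
    HasProjectiveDimensionLE (ModuleCat.of R (Fin k → R ⧸ Ideal.span {W})) 1 := by
  let f : (Fin k → R) →ₗ[R] (Fin k → R) := LinearMap.lsmul R _ W
  let g : (Fin k → R) →ₗ[R] (Fin k → R ⧸ Ideal.span {W}) :=
    (Submodule.mkQ (Ideal.span {W})).compLeft (Fin k)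
  have hfg : Function.Exact f g := by
    intro v
    have : g v = 0 ↔ ∀ i, v i ∈ Ideal.span {W} := by
      simp [g, funext_iff, Ideal.Quotient.eq_zero_iff_mem]
    rw [this]
    refine ⟨fun h ↦ ?_, ?_⟩
    · choose w hw using fun i ↦ Ideal.mem_span_singleton'.mp (h i)
      exact ⟨w, funext fun i ↦ by simp [f, ← hw i, mul_comm]⟩
    · rintro ⟨w, rfl⟩ i
      exact Ideal.mem_span_singleton'.mpr ⟨w i, by simp [f, mul_comm]⟩
  have hf : Function.Injective f := by
    refine (injective_iff_map_eq_zero f).mpr fun v hv ↦ funext fun i ↦ ?_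
    have : W * v i = 0 := congrFun hv i
    exact (mul_left_mem_nonZeroDivisors_eq_zero_iff hW).mp this
  have hg : Function.Surjective g := fun v ↦ by
    choose w hw using fun i ↦ Submodule.mkQ_surjective _ (v i)
    exact ⟨w, funext hw⟩
  have hS := ModuleCat.shortComplex_shortExact
    (ShortComplex.moduleCatMk f g hfg.linearMap_comp_eq_zero) hfg hf hg
  have h (n : ℕ) : HasProjectiveDimensionLT (ModuleCat.of R (Fin k → R)) (n + 1) := inferInstance
  exact hS.hasProjectiveDimensionLT_X₃ 1 (h 0) (h 1)

lemma localizedModuleMap_smul_id (S : Submonoid R) (M : ModuleCat.{0} R) (x : R) :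
    ModuleCat.localizedModuleMap S (x • 𝟙 M) =
      algebraMap R (Localization S) x • 𝟙 (M.localizedModule S) := by
  ext y
  simp only [ModuleCat.localizedModuleMap, ModuleCat.hom_smul, ModuleCat.hom_id, map_smul,
    algebraMap_smul]
  exact congrArg (x • ·) (LinearMap.congr_fun
    (IsLocalizedModule.map_id S (M.localizedModuleMkLinearMap S)) y)

variable {E F M : Type} [AddCommGroup E] [AddCommGroup F] [AddCommGroup M]
  [Module R E] [Module R F] [Module R M]

lemma shortExact_coprod_smul {π : F →ₗ[R] M} (hπ : Function.Surjective π) {x : R}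
    {j : E →ₗ[R] F × M} (hj : Function.Injective j)
    (hexact : Function.Exact j (π.coprod (x • LinearMap.id))) :
    (ShortComplex.moduleCatMk j (π.coprod (x • LinearMap.id))
      hexact.linearMap_comp_eq_zero).ShortExact := by
  have hsurj : Function.Surjective (π.coprod (x • LinearMap.id)) := fun y ↦ by
    obtain ⟨u, rfl⟩ := hπ y
    exact ⟨(u, 0), by simp⟩
  exact ModuleCat.shortComplex_shortExact _ hexact hj hsurj

lemma isLocalizedModule_comp_fst_comp (S : Submonoid R) {π : F →ₗ[R] M} {x : R} (hx : x ∈ S)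
    {j : E →ₗ[R] F × M} (hj : Function.Injective j)
    (hexact : Function.Exact j (π.coprod (x • LinearMap.id)))
    {F' : Type} [AddCommGroup F'] [Module R F'] (f : F →ₗ[R] F') [IsLocalizedModule S f] :
    IsLocalizedModule S (f ∘ₗ LinearMap.fst R F M ∘ₗ j) where
  map_units := IsLocalizedModule.map_units f
  surj y := by
    obtain ⟨⟨u, s⟩, hu⟩ := IsLocalizedModule.surj S f y
    obtain ⟨e, he⟩ := (hexact (x • u, -π u)).mp (by simp)
    refine ⟨⟨e, ⟨x, hx⟩ * s⟩, ?_⟩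
    simp only [mul_smul, hu]
    simp [he, Submonoid.smul_def]
  exists_of_eq {e₁ e₂} h := by
    obtain ⟨c, hc⟩ := IsLocalizedModule.exists_of_eq (S := S) (f := f) h
    refine ⟨⟨x, hx⟩ * c, hj ?_⟩
    have h₁ := hexact.apply_apply_eq_zero e₁
    have h₂ := hexact.apply_apply_eq_zero e₂
    simp only [LinearMap.coprod_apply, LinearMap.smul_apply, LinearMap.id_apply] at h₁ h₂
    simp only [LinearMap.comp_apply, LinearMap.fst_apply, Submonoid.smul_def] at hc
    simp only [Submonoid.smul_def, Submonoid.coe_mul, map_smul]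
    refine Prod.ext ?_ ?_
    · simp only [Prod.smul_fst, mul_smul, hc]
    · rw [Prod.smul_snd, Prod.smul_snd, mul_comm, mul_smul, mul_smul,
        eq_neg_of_add_eq_zero_right h₁, eq_neg_of_add_eq_zero_right h₂, smul_neg, smul_neg,
        ← map_smul, ← map_smul, hc]

lemma hasProjectiveDimensionLE_of_exact_coprod_smul [IsNoetherianRing R] [Module.Finite R E]
    {π : F →ₗ[R] M} (hπ : Function.Surjective π) {x : R}
    {j : E →ₗ[R] F × M} (hj : Function.Injective j)
    (hexact : Function.Exact j (π.coprod (x • LinearMap.id))) {n : ℕ}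
    (hF : HasProjectiveDimensionLE (ModuleCat.of R F) n)
    (hM : ∀ q : PrimeSpectrum R, x ∈ q.asIdeal →
      HasProjectiveDimensionLE ((ModuleCat.of R M).localizedModule q.asIdeal.primeCompl) n) :
    HasProjectiveDimensionLE (ModuleCat.of R E) n := by
  have : Module.Finite R (ModuleCat.of R E) := ‹Module.Finite R E›
  rw [ModuleCat.hasProjectiveDimensionLE_iff_forall_maximalSpectrum]
  intro q
  let S := q.asIdeal.primeCompl
  have hFS : HasProjectiveDimensionLE ((ModuleCat.of R F).localizedModule S) n :=
    ModuleCat.localizedModule_hasProjectiveDimensionLE n S _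
  by_cases hx : x ∈ q.asIdeal
  · have hMS : HasProjectiveDimensionLE ((ModuleCat.of R M).localizedModule S) n :=
      hM q.toPrimeSpectrum hx
    have hsplit : Function.Exact (LinearMap.inl R F M) (LinearMap.snd R F M) :=
      Function.Exact.inl_snd
    have hprod := (ModuleCat.shortComplex_shortExact
      (ShortComplex.moduleCatMk _ _ hsplit.linearMap_comp_eq_zero) hsplit
      (LinearMap.inl_injective (R := R) (M := F) (M₂ := M))
      (LinearMap.snd_surjective (R := R) (M := F) (M₂ := M))).map_of_exact
      (ModuleCat.localizedModuleFunctor S)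
    refine ((shortExact_coprod_smul hπ hj hexact).map_of_exact
      (ModuleCat.localizedModuleFunctor S)).hasProjectiveDimensionLT_X₁ (n + 1)
      (hprod.hasProjectiveDimensionLT_X₂ (n + 1) hFS hMS) ?_
    exact hasProjectiveDimensionLT_of_ge
      ((ModuleCat.of R M).localizedModule S) (n + 1) (n + 2) (by lia)
  · have h (X : ModuleCat.{0} R) : IsLocalizedModule S (X.localizedModuleMkLinearMap S) :=
      inferInstance
    have := h (ModuleCat.of R F)
    have : IsLocalizedModule S (((ModuleCat.of R F).localizedModuleMkLinearMap S) ∘ₗ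
        LinearMap.fst R F M ∘ₗ j) :=
      isLocalizedModule_comp_fst_comp S hx hj hexact _
    exact (hasProjectiveDimensionLE_localizedModule_iff S (ModuleCat.of R E)
      (((ModuleCat.of R F).localizedModuleMkLinearMap S) ∘ₗ LinearMap.fst R F M ∘ₗ j) n).mpr hFS

lemma hasProjectiveDimensionLE_localizedModule_of_exact_coprod_smul [IsNoetherianRing R]
    [Module.Finite R M] (S : Submonoid R) {π : F →ₗ[R] M} (hπ : Function.Surjective π) {x : R}
    (hx : algebraMap R (Localization S) x ∈ (⊥ : Ideal (Localization S)).jacobson)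
    {j : E →ₗ[R] F × M} (hj : Function.Injective j)
    (hexact : Function.Exact j (π.coprod (x • LinearMap.id))) {n : ℕ}
    (hE : HasProjectiveDimensionLE ((ModuleCat.of R E).localizedModule S) n) :
    HasProjectiveDimensionLE ((ModuleCat.of R M).localizedModule S) n := by
  let L := ModuleCat.localizedModuleFunctor.{0} S
  let i : ModuleCat.of R M ⟶ ModuleCat.of R (F × M) := ModuleCat.ofHom (LinearMap.inr R F M)
  let r : ModuleCat.of R (F × M) ⟶ ModuleCat.of R M := ModuleCat.ofHom (LinearMap.snd R F M)
  let g : ModuleCat.of R (F × M) ⟶ ModuleCat.of R M :=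
    ModuleCat.ofHom (π.coprod (x • LinearMap.id))
  have hr : L.map i ≫ L.map r = 𝟙 ((ModuleCat.of R M).localizedModule S) :=
    (L.map_comp i r).symm.trans (L.map_id _)
  have hg : L.map i ≫ L.map g =
      algebraMap R (Localization S) x • 𝟙 ((ModuleCat.of R M).localizedModule S) := by
    have : i ≫ g = x • 𝟙 _ := by ext; simp [i, g]
    refine (L.map_comp i g).symm.trans ?_
    rw [this]
    exact localizedModuleMap_smul_id S _ x
  have := IsLocalization.isNoetherianRing S (Localization S) ‹_›
  have (X : ModuleCat.{0} R) [Module.Finite R X] :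
      Module.Finite (Localization S) (X.localizedModule S) :=
    Module.Finite.of_isLocalizedModule S (X.localizedModuleMkLinearMap S)
  have := this (ModuleCat.of R M)
  exact hasProjectiveDimensionLT_of_smul_factorization
    (X₁ := (ModuleCat.of R E).localizedModule S) (X₃ := (ModuleCat.of R M).localizedModule S) hx
    ((shortExact_coprod_smul hπ hj hexact).map_of_exact L) (L.map i) (L.map r) hr hg (n + 1)

end ApproximationModule

lemma exists_finite_isLocalizedModule {A : Type} [CommRing A] (S : Submonoid A)
    (N : Type) [AddCommGroup N] [Module A N] [Module (Localization S) N]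
    [IsScalarTower A (Localization S) N] [Module.Finite (Localization S) N] :
    ∃ M : Submodule A N, M.FG ∧ IsLocalizedModule S M.subtype := by
  obtain ⟨G, hG⟩ := Module.Finite.fg_top (R := Localization S) (M := N)
  refine ⟨Submodule.span A G, ⟨G, rfl⟩, ?_, fun y ↦ ?_, fun {y₁ y₂} h ↦ ⟨1, ?_⟩⟩
  · intro s
    have := (IsLocalization.map_units (Localization S) s).map
      (Module.toModuleEnd A (S := Localization S) N)
    convert this
    ext y
    simp
  · obtain ⟨t, ht⟩ := multiple_mem_span_of_mem_localization_span S (Localization S) (G : Set N) y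
      (hG ▸ trivial)
    exact ⟨⟨⟨_, ht⟩, t⟩, rfl⟩
  · rw [Subtype.ext h]

section Quotient

variable {R : Type} [CommRing R] (W : R) (m : Ideal R) [m.IsPrime]

lemma locQuotMap_algebraMap (r : R) : locQuotMap R W m (algebraMap R _ r) =
    algebraMap (R ⧸ Ideal.span {W}) _ (Ideal.Quotient.mk (Ideal.span {W}) r) :=
  IsLocalization.map_eq _ _

lemma locQuotMap_surjective : Function.Surjective (locQuotMap R W m) :=
  IsLocalization.map_surjective_of_surjective _ _ _ Ideal.Quotient.mk_surjective

lemma algebraMap_mk_mem_jacobson_bot {x : R} (hx : x ∈ m) :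
    algebraMap (R ⧸ Ideal.span {W}) (Localization (imageSubmonoid R W m))
      (Ideal.Quotient.mk (Ideal.span {W}) x) ∈
      (⊥ : Ideal (Localization (imageSubmonoid R W m))).jacobson := by
  rw [Ideal.mem_jacobson_bot, ← locQuotMap_algebraMap]
  intro y
  obtain ⟨y, rfl⟩ := locQuotMap_surjective W m y
  rw [← map_mul, ← map_one (locQuotMap R W m), ← map_add]
  refine IsUnit.map _ (Ideal.mem_jacobson_bot.mp ?_ y)
  rw [IsLocalRing.jacobson_eq_maximalIdeal _ bot_ne_top]
  exact (IsLocalization.AtPrime.to_map_mem_maximal_iff _ m x).mpr hx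

lemma hasProjectiveDimensionLE_localizedModule_iff_locQuotMap
    (M : Type) [AddCommGroup M] [Module R M] [Module (R ⧸ Ideal.span {W}) M]
    [IsScalarTower R (R ⧸ Ideal.span {W}) M] (N : Type) [AddCommGroup N]
    [Module (R ⧸ Ideal.span {W}) N] [Module (Localization (imageSubmonoid R W m)) N]
    [IsScalarTower (R ⧸ Ideal.span {W}) (Localization (imageSubmonoid R W m)) N]
    (f : M →ₗ[R ⧸ Ideal.span {W}] N) [hf : IsLocalizedModule (imageSubmonoid R W m) f] (n : ℕ) :
    HasProjectiveDimensionLE ((ModuleCat.of R M).localizedModule m.primeCompl) n ↔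
      letI : Module (Localization.AtPrime m) N := Module.compHom N (locQuotMap R W m)
      HasProjectiveDimensionLE (ModuleCat.of (Localization.AtPrime m) N) n := by
  let _ : Module (Localization.AtPrime m) N := Module.compHom N (locQuotMap R W m)
  let _ : Module R N := Module.compHom N (Ideal.Quotient.mk (Ideal.span {W}))
  have : IsScalarTower R (R ⧸ Ideal.span {W}) N := .of_algebraMap_smul fun _ _ ↦ rfl
  have : IsScalarTower R (Localization.AtPrime m) N := .of_algebraMap_smul fun r y ↦ by
    change locQuotMap R W m (algebraMap R _ r) • y = _
    rw [locQuotMap_algebraMap, algebraMap_smul]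
    rfl
  have : IsLocalizedModule (Algebra.algebraMapSubmonoid _ m.primeCompl) f := hf
  have := IsLocalizedModule.restrictScalars m.primeCompl f
  exact hasProjectiveDimensionLE_localizedModule_iff m.primeCompl (ModuleCat.of R M)
    (f.restrictScalars R) n

end Quotient

theorem stmt3 (R : Type) [CommRing R] [IsNoetherianRing R]
    (W : R) (hW : W ∈ nonZeroDivisors R)
    (m : Ideal R) (hm : m.IsMaximal) (hWm : W ∈ m) :
    haveI : m.IsPrime := hm.isPrime
    ((∃ (M : Type) (_ : AddCommGroup M) (_ : Module (R ⧸ Ideal.span {W}) M),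
        Module.Finite (R ⧸ Ideal.span {W}) M ∧
        (letI : Module R M := Module.compHom M (Ideal.Quotient.mk (Ideal.span {W}));
          HasFinProjDim R M) ∧
        ¬ HasFinProjDim (Localization (imageSubmonoid R W m))
            (LocalizedModule (imageSubmonoid R W m) M)) ↔
      (∃ (N : Type) (_ : AddCommGroup N)
          (_ : Module (Localization (imageSubmonoid R W m)) N),
        Module.Finite (Localization (imageSubmonoid R W m)) N ∧
        ¬ HasFinProjDim (Localization (imageSubmonoid R W m)) N ∧
        (letI : Module (Localization.AtPrime m) N :=
            Module.compHom N (locQuotMap R W m);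
          HasFinProjDim (Localization.AtPrime m) N))) := by
  have := hm.isPrime
  let A := R ⧸ Ideal.span {W}
  let S := imageSubmonoid R W m
  constructor
  · rintro ⟨M, _, _, _, hfin, hinf⟩
    let _ : Module R M := Module.compHom M (Ideal.Quotient.mk (Ideal.span {W}))
    have : IsScalarTower R A M := .of_algebraMap_smul fun _ _ ↦ rfl
    obtain ⟨n, _⟩ := hasFinProjDim_iff.mp hfin
    let _ : Module (Localization.AtPrime m) (LocalizedModule S M) :=
      Module.compHom _ (locQuotMap R W m)
    refine ⟨LocalizedModule S M, inferInstance, inferInstance,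
      Module.Finite.of_isLocalizedModule S (LocalizedModule.mkLinearMap S M), hinf,
      hasFinProjDim_iff.mpr ⟨n, ?_⟩⟩
    exact (hasProjectiveDimensionLE_localizedModule_iff_locQuotMap W m M (LocalizedModule S M)
      (LocalizedModule.mkLinearMap S M) n).mp
      (ModuleCat.localizedModule_hasProjectiveDimensionLE n _ _)
  · rintro ⟨N, _, _, _, hinf, hfin⟩
    let _ : Module A N := Module.compHom N (algebraMap A (Localization S))
    have : IsScalarTower A (Localization S) N := .of_algebraMap_smul fun _ _ ↦ rfl
    let _ : Module (Localization.AtPrime m) N := Module.compHom N (locQuotMap R W m)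
    obtain ⟨M, hMfg, hM⟩ := exists_finite_isLocalizedModule S N
    have : Module.Finite A M := Module.Finite.iff_fg.mpr hMfg
    let _ : Module R M := Module.compHom M (Ideal.Quotient.mk (Ideal.span {W}))
    have : IsScalarTower R A M := .of_algebraMap_smul fun _ _ ↦ rfl
    have : Module.Finite R M := .trans A M
    obtain ⟨n, hn⟩ := hasFinProjDim_iff.mp hfin
    obtain ⟨s, hs, hsq⟩ := exists_notMem_forall_hasProjectiveDimensionLE ⟨m, hm.isPrime⟩
      (ModuleCat.of R M) n ((hasProjectiveDimensionLE_localizedModule_iff_locQuotMap W m M N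
        M.subtype n).mpr hn)
    obtain ⟨a, x, hx, hax⟩ := hm.exists_inv hs
    obtain ⟨k, π, hπ⟩ := Module.Finite.exists_fin' A M
    let g := π.coprod (Ideal.Quotient.mk (Ideal.span {W}) x • LinearMap.id)
    obtain ⟨E, _, _, j, _, hj, hexact⟩ : ∃ (E : Type) (_ : AddCommGroup E) (_ : Module A E)
        (j : E →ₗ[A] (Fin k → A) × M), Module.Finite A E ∧ Function.Injective j ∧
        Function.Exact j g :=
      ⟨LinearMap.ker g, inferInstance, inferInstance, (LinearMap.ker g).subtype, inferInstance,
        Subtype.val_injective, LinearMap.exact_subtype_ker_map g⟩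
    refine ⟨E, inferInstance, inferInstance, ‹_›, ?_, fun h ↦ hinf ?_⟩
    · let _ : Module R E := Module.compHom E (Ideal.Quotient.mk (Ideal.span {W}))
      have : IsScalarTower R A E := .of_algebraMap_smul fun _ _ ↦ rfl
      have : Module.Finite R E := .trans A E
      refine hasFinProjDim_iff.mpr ⟨n + 1, ?_⟩
      refine hasProjectiveDimensionLE_of_exact_coprod_smul (π := π.restrictScalars R) (x := x)
        (j := j.restrictScalars R) hπ hj hexact ?_ fun q hxq ↦ ?_
      · have := hasProjectiveDimensionLE_pi_quotient hW k
        exact hasProjectiveDimensionLT_of_ge _ 2 (n + 2) (by lia)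
      · have := hsq q fun hsq ↦ q.isPrime.one_notMem
          (hax ▸ add_mem (Ideal.mul_mem_left _ a hsq) hxq)
        exact hasProjectiveDimensionLT_of_ge _ (n + 1) (n + 2) (by lia)
    · obtain ⟨d, hd⟩ := hasFinProjDim_iff.mp h
      have hE := (hasProjectiveDimensionLE_localizedModule_iff S (ModuleCat.of A E)
        (LocalizedModule.mkLinearMap S E) d).mpr hd
      exact hasFinProjDim_iff.mpr ⟨d, (hasProjectiveDimensionLE_localizedModule_iff S
        (ModuleCat.of A M) M.subtype d).mp
        (hasProjectiveDimensionLE_localizedModule_of_exact_coprod_smul S hπ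
          (algebraMap_mk_mem_jacobson_bot W m hx) hj hexact hE)⟩
end

section
/- Let R be a Noetherian commutative ring, W ∈ R a non-zero-divisor, and Z ⊆ Spec R a Zariski-closed subset such that every point of Z lies in Supp(E) for some matrix factorization E of W over R. Then there exists a matrix factorization F of W over R with Supp(F) = Z. -/
open Matrix

/-- A (proof-free) matrix factorization datum over a commutative ring `R`:
two finite free modules presented by finite index types together with the two
structure matrices `A` (for `φ₁ : F₁ → F₀`) and `B` (for `φ₀ : F₀ → F₁`). -/
structure MF (R : Type) [CommRing R] : Type 1 where
  ι1 : Type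
  ι0 : Type
  [fin1 : Fintype ι1]
  [fin0 : Fintype ι0]
  [dec1 : DecidableEq ι1]
  [dec0 : DecidableEq ι0]
  A : Matrix ι0 ι1 R
  B : Matrix ι1 ι0 R

attribute [instance] MF.fin1 MF.fin0 MF.dec1 MF.dec0

namespace MF

variable {R S : Type} [CommRing R] [CommRing S]

/-- `F` is a matrix factorization of `w`: `φ₀ ∘ φ₁ = w • id` and `φ₁ ∘ φ₀ = w • id`. -/
def IsMF (w : R) (F : MF R) : Prop :=
  F.B * F.A = w • (1 : Matrix F.ι1 F.ι1 R) ∧ F.A * F.B = w • (1 : Matrix F.ι0 F.ι0 R)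

/-- A matrix factorization is contractible if the identity is null-homotopic. -/
def Contractible (F : MF R) : Prop :=
  ∃ (h0 : Matrix F.ι1 F.ι0 R) (h1 : Matrix F.ι0 F.ι1 R),
    (1 : Matrix F.ι0 F.ι0 R) = F.A * h0 + h1 * F.B ∧
    (1 : Matrix F.ι1 F.ι1 R) = F.B * h1 + h0 * F.A

/-- Base change of a matrix factorization along a ring homomorphism. -/
def map (f : R →+* S) (F : MF R) : MF S where
  ι1 := F.ι1
  ι0 := F.ι0
  A := F.A.map f
  B := F.B.map f

/-- The support of a matrix factorization: the primes where its localization is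
not contractible. -/
def Supp (F : MF R) : Set (PrimeSpectrum R) :=
  { p | ¬ Contractible (F.map (algebraMap R (Localization.AtPrime p.asIdeal))) }

end MF

namespace MF

variable {R S : Type} [CommRing R] [CommRing S]

theorem Contractible.map {F : MF R} (h : F.Contractible) (f : R →+* S) :
    (F.map f).Contractible := by
  obtain ⟨h0, h1, e0, e1⟩ := h
  refine ⟨h0.map f, h1.map f, ?_, ?_⟩
  · change (1 : Matrix F.ι0 F.ι0 S) = F.A.map f * h0.map f + h1.map f * F.B.map f
    simpa [Matrix.map_add, Matrix.map_mul] using congrArg (fun M => M.map f) e0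
  · change (1 : Matrix F.ι1 F.ι1 S) = F.B.map f * h1.map f + h0.map f * F.A.map f
    simpa [Matrix.map_add, Matrix.map_mul] using congrArg (fun M => M.map f) e1

/-- Supports are stable under specialization. -/
theorem mem_Supp_of_le (F : MF R) {p q : PrimeSpectrum R} (hpq : p.asIdeal ≤ q.asIdeal)
    (hp : p ∈ F.Supp) : q ∈ F.Supp := by
  intro hq
  have hu : ∀ y : q.asIdeal.primeCompl,
      IsUnit (algebraMap R (Localization.AtPrime p.asIdeal) y) := fun y =>
    (IsLocalization.AtPrime.isUnit_to_map_iff _ p.asIdeal _).2 fun hy => y.2 (hpq hy)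
  have h := hq.map (IsLocalization.lift (S := Localization.AtPrime q.asIdeal) hu)
  apply hp
  have e : (F.map (algebraMap R (Localization.AtPrime q.asIdeal))).map
      (IsLocalization.lift hu) = F.map (algebraMap R (Localization.AtPrime p.asIdeal)) := by
    simp only [MF.map, Matrix.map_map]
    simp only [← RingHom.coe_comp, IsLocalization.lift_comp]
  rwa [e] at h

/-- The direct sum of two matrix factorizations. -/
def sum (F G : MF R) : MF R where
  ι1 := F.ι1 ⊕ G.ι1
  ι0 := F.ι0 ⊕ G.ι0
  A := fromBlocks F.A 0 0 G.A
  B := fromBlocks F.B 0 0 G.B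

theorem IsMF.sum {w : R} {F G : MF R} (hF : F.IsMF w) (hG : G.IsMF w) :
    (F.sum G).IsMF w := by
  constructor
  · change fromBlocks F.B 0 0 G.B * fromBlocks F.A 0 0 G.A =
      w • (1 : Matrix (F.ι1 ⊕ G.ι1) (F.ι1 ⊕ G.ι1) R)
    simp [fromBlocks_multiply, hF.1, hG.1, ← fromBlocks_one, fromBlocks_smul]
  · change fromBlocks F.A 0 0 G.A * fromBlocks F.B 0 0 G.B =
      w • (1 : Matrix (F.ι0 ⊕ G.ι0) (F.ι0 ⊕ G.ι0) R)
    simp [fromBlocks_multiply, hF.2, hG.2, ← fromBlocks_one, fromBlocks_smul]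

theorem sum_map (F G : MF R) (f : R →+* S) :
    (F.sum G).map f = (F.map f).sum (G.map f) := by
  refine congrArg₂ (fun A B => (⟨F.ι1 ⊕ G.ι1, F.ι0 ⊕ G.ι0, A, B⟩ : MF S))
    (x' := fromBlocks (F.A.map f) 0 0 (G.A.map f))
    (y' := fromBlocks (F.B.map f) 0 0 (G.B.map f)) ?_ ?_
  · simp [MF.sum, fromBlocks_map]
  · simp [MF.sum, fromBlocks_map]

theorem contractible_sum_iff {F G : MF R} : (F.sum G).Contractible ↔
    ∃ (h0 : Matrix (F.ι1 ⊕ G.ι1) (F.ι0 ⊕ G.ι0) R) (h1 : Matrix (F.ι0 ⊕ G.ι0) (F.ι1 ⊕ G.ι1) R),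
      1 = fromBlocks F.A 0 0 G.A * h0 + h1 * fromBlocks F.B 0 0 G.B ∧
      1 = fromBlocks F.B 0 0 G.B * h1 + h0 * fromBlocks F.A 0 0 G.A :=
  Iff.rfl

theorem Contractible.of_sum {F G : MF R} (h : (F.sum G).Contractible) :
    F.Contractible ∧ G.Contractible := by
  obtain ⟨h0, h1, e0, e1⟩ := contractible_sum_iff.1 h
  rw [← fromBlocks_toBlocks h0, ← fromBlocks_toBlocks h1] at e0 e1
  simp only [fromBlocks_multiply, fromBlocks_add, ← fromBlocks_one,
    fromBlocks_inj, Matrix.zero_mul, Matrix.mul_zero, add_zero, zero_add] at e0 e1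
  exact ⟨⟨_, _, e0.1, e1.1⟩, ⟨_, _, e0.2.2.2, e1.2.2.2⟩⟩

theorem Supp_union_subset_sum (F G : MF R) : F.Supp ∪ G.Supp ⊆ (F.sum G).Supp := by
  intro p hp h
  rw [sum_map] at h
  exact hp.elim (fun hF => hF h.of_sum.1) fun hG => hG h.of_sum.2

/-- The mapping cone of multiplication by `a` on a matrix factorization. -/
def cone (a : R) (F : MF R) : MF R where
  ι1 := F.ι1 ⊕ F.ι0
  ι0 := F.ι0 ⊕ F.ι1
  A := fromBlocks F.A (a • 1) 0 (-F.B)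
  B := fromBlocks F.B (a • 1) 0 (-F.A)

theorem IsMF.cone {w : R} {F : MF R} (hF : F.IsMF w) (a : R) : (F.cone a).IsMF w := by
  constructor
  · change fromBlocks F.B (a • 1) 0 (-F.A) * fromBlocks F.A (a • 1) 0 (-F.B) =
      w • (1 : Matrix (F.ι1 ⊕ F.ι0) (F.ι1 ⊕ F.ι0) R)
    simp [fromBlocks_multiply, hF.1, hF.2, ← fromBlocks_one, fromBlocks_smul]
  · change fromBlocks F.A (a • 1) 0 (-F.B) * fromBlocks F.B (a • 1) 0 (-F.A) =
      w • (1 : Matrix (F.ι0 ⊕ F.ι1) (F.ι0 ⊕ F.ι1) R)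
    simp [fromBlocks_multiply, hF.1, hF.2, ← fromBlocks_one, fromBlocks_smul]

theorem cone_map (a : R) (F : MF R) (f : R →+* S) :
    (F.cone a).map f = (F.map f).cone (f a) := by
  have smul_one_map (n : Type) [DecidableEq n] :
      (a • (1 : Matrix n n R)).map f = f a • (1 : Matrix n n S) := by
    ext i j
    simp [Matrix.one_apply, apply_ite f]
  have neg_map {m n : Type} (M : Matrix m n R) : (-M).map f = -(M.map f) := by
    ext i j
    simp
  refine congrArg₂ (fun A B => (⟨F.ι1 ⊕ F.ι0, F.ι0 ⊕ F.ι1, A, B⟩ : MF S))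
    (x' := fromBlocks (F.A.map f) (f a • 1) 0 (-(F.B.map f)))
    (y' := fromBlocks (F.B.map f) (f a • 1) 0 (-(F.A.map f))) ?_ ?_
  · simp [MF.cone, fromBlocks_map, smul_one_map, neg_map]
  · simp [MF.cone, fromBlocks_map, smul_one_map, neg_map]

theorem contractible_cone_iff {a : R} {F : MF R} : (F.cone a).Contractible ↔
    ∃ (h0 : Matrix (F.ι1 ⊕ F.ι0) (F.ι0 ⊕ F.ι1) R) (h1 : Matrix (F.ι0 ⊕ F.ι1) (F.ι1 ⊕ F.ι0) R),
      1 = fromBlocks F.A (a • 1) 0 (-F.B) * h0 + h1 * fromBlocks F.B (a • 1) 0 (-F.A) ∧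
      1 = fromBlocks F.B (a • 1) 0 (-F.A) * h1 + h0 * fromBlocks F.A (a • 1) 0 (-F.B) :=
  Iff.rfl

theorem Contractible.cone {F : MF R} (h : F.Contractible) (a : R) :
    (F.cone a).Contractible := by
  obtain ⟨h0, h1, e0, e1⟩ := h
  refine contractible_cone_iff.2 ⟨fromBlocks h0 0 0 (-h1), fromBlocks h1 0 0 (-h0), ?_, ?_⟩
  · simp [fromBlocks_multiply, fromBlocks_add, ← fromBlocks_one, ← e0, ← e1]
  · simp [fromBlocks_multiply, fromBlocks_add, ← fromBlocks_one, ← e0, ← e1]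

theorem contractible_cone_of_isUnit {a : R} (ha : IsUnit a) (F : MF R) :
    (F.cone a).Contractible := by
  obtain ⟨b, hb⟩ := ha.exists_right_inv
  refine contractible_cone_iff.2
    ⟨fromBlocks 0 0 (b • 1) 0, fromBlocks 0 0 (b • 1) 0, ?_, ?_⟩
  · simp [fromBlocks_multiply, fromBlocks_add, ← fromBlocks_one, smul_smul, hb,
      mul_comm b a]
  · simp [fromBlocks_multiply, fromBlocks_add, ← fromBlocks_one, smul_smul, hb,
      mul_comm b a]

theorem isUnit_one_sub_smul [IsLocalRing R] {n : Type} [Fintype n] [DecidableEq n]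
    {a : R} (ha : ¬ IsUnit a) (r : Matrix n n R) : IsUnit (1 - a • r) := by
  rw [Matrix.isUnit_iff_isUnit_det]
  apply isUnit_of_map_unit (IsLocalRing.residue R)
  have ha' : IsLocalRing.residue R a = 0 := by
    rwa [IsLocalRing.residue_eq_zero_iff, IsLocalRing.mem_maximalIdeal]
  have e : (IsLocalRing.residue R).mapMatrix (1 - a • r) = 1 := by
    rw [map_sub, map_one, sub_eq_self]
    ext i j
    simp [ha']
  rw [RingHom.map_det, e, det_one]
  exact isUnit_one

/-- If an invertible endomorphism is null-homotopic, then so is the identity. -/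
theorem contractible_of_isUnit {F : MF R} {X0 : Matrix F.ι0 F.ι0 R} {X1 : Matrix F.ι1 F.ι1 R}
    (hX0 : IsUnit X0) (hX1 : IsUnit X1) (hA : F.A * X1 = X0 * F.A) (hB : F.B * X0 = X1 * F.B)
    {h0 : Matrix F.ι1 F.ι0 R} {h1 : Matrix F.ι0 F.ι1 R}
    (e0 : X0 = F.A * h0 + h1 * F.B) (e1 : X1 = F.B * h1 + h0 * F.A) : F.Contractible := by
  obtain ⟨Y0, hY0, hY0'⟩ := isUnit_iff_exists.1 hX0
  obtain ⟨Y1, hY1, hY1'⟩ := isUnit_iff_exists.1 hX1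
  have hA' : Y0 * F.A = F.A * Y1 := by
    calc Y0 * F.A = Y0 * (F.A * X1) * Y1 := by
          rw [Matrix.mul_assoc, Matrix.mul_assoc, hY1, Matrix.mul_one]
      _ = F.A * Y1 := by rw [hA, ← Matrix.mul_assoc, hY0', Matrix.one_mul]
  have hB' : Y1 * F.B = F.B * Y0 := by
    calc Y1 * F.B = Y1 * (F.B * X0) * Y0 := by
          rw [Matrix.mul_assoc, Matrix.mul_assoc, hY0, Matrix.mul_one]
      _ = F.B * Y0 := by rw [hB, ← Matrix.mul_assoc, hY1', Matrix.one_mul]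
  refine ⟨h0 * Y0, h1 * Y1, ?_, ?_⟩
  · rw [Matrix.mul_assoc h1, hB', ← Matrix.mul_assoc, ← Matrix.mul_assoc, ← Matrix.add_mul,
      ← e0, hY0]
  · rw [Matrix.mul_assoc h0, hA', ← Matrix.mul_assoc, ← Matrix.mul_assoc, ← Matrix.add_mul,
      ← e1, hY1]

theorem Contractible.of_cone [IsLocalRing R] {a : R} (ha : ¬ IsUnit a) {F : MF R}
    (h : (F.cone a).Contractible) : F.Contractible := by
  obtain ⟨h0, h1, e0, e1⟩ := contractible_cone_iff.1 h
  rw [← fromBlocks_toBlocks h0, ← fromBlocks_toBlocks h1] at e0 e1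
  simp only [fromBlocks_multiply, fromBlocks_add, ← fromBlocks_one,
    fromBlocks_inj, Matrix.zero_mul, Matrix.mul_zero, add_zero, zero_add, Matrix.smul_mul,
    Matrix.one_mul, Matrix.neg_mul] at e0 e1
  obtain ⟨e0, -, c0, -⟩ := e0
  obtain ⟨e1, -, c1, -⟩ := e1
  have c0' := (neg_add_eq_zero.1 c0.symm)
  have c1' := (neg_add_eq_zero.1 c1.symm)
  refine contractible_of_isUnit (isUnit_one_sub_smul ha h0.toBlocks₂₁)
    (isUnit_one_sub_smul ha h1.toBlocks₂₁) ?_ ?_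
    (h0 := h0.toBlocks₁₁) (h1 := h1.toBlocks₁₁) ?_ ?_
  · simp [Matrix.mul_sub, Matrix.sub_mul, c1']
  · simp [Matrix.mul_sub, Matrix.sub_mul, c0']
  · rw [sub_eq_iff_eq_add]
    exact e0.trans (by abel)
  · rw [sub_eq_iff_eq_add]
    exact e1.trans (by abel)

theorem Supp_cone (a : R) (F : MF R) :
    (F.cone a).Supp = F.Supp ∩ PrimeSpectrum.zeroLocus {a} := by
  ext p
  have hu := IsLocalization.AtPrime.isUnit_to_map_iff (Localization.AtPrime p.asIdeal) p.asIdeal a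
  simp only [Supp, Set.mem_ofPred_eq, Set.mem_inter_iff, PrimeSpectrum.mem_zeroLocus,
    Set.singleton_subset_iff, SetLike.mem_coe, cone_map]
  constructor
  · exact fun h => ⟨fun hF => h (hF.cone _), by_contra fun hp =>
      h (contractible_cone_of_isUnit (hu.2 hp) _)⟩
  · exact fun h hc => h.1 (hc.of_cone fun hun => hu.1 hun h.2)

theorem exists_Supp_eq_inter_zeroLocus {w : R} {F : MF R} (hF : F.IsMF w) (s : Finset R) :
    ∃ G : MF R, G.IsMF w ∧ G.Supp = F.Supp ∩ PrimeSpectrum.zeroLocus (s : Set R) := by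
  classical
  induction s using Finset.induction_on with
  | empty => exact ⟨F, hF, by simp⟩
  | insert a s _ ih =>
    obtain ⟨G, hG, e⟩ := ih
    refine ⟨G.cone a, hG.cone a, ?_⟩
    rw [Supp_cone, e, Finset.coe_insert, Set.insert_eq, PrimeSpectrum.zeroLocus_union,
      Set.inter_assoc, Set.inter_comm (PrimeSpectrum.zeroLocus _)]

theorem exists_subset_Supp_of_finite {w : R} {T : Set (PrimeSpectrum R)} (hT : T.Finite)
    (h : ∀ p ∈ T, ∃ E : MF R, E.IsMF w ∧ p ∈ E.Supp) :
    ∃ F : MF R, F.IsMF w ∧ T ⊆ F.Supp := by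
  induction T, hT using Set.Finite.induction_on with
  | empty =>
    exact ⟨⟨Empty, Empty, 0, 0⟩, ⟨Subsingleton.elim _ _, Subsingleton.elim _ _⟩,
      Set.empty_subset _⟩
  | @insert p T _ _ ih =>
    obtain ⟨F, hF, hTF⟩ := ih fun q hq => h q (Set.mem_insert_of_mem _ hq)
    obtain ⟨E, hE, hpE⟩ := h p (Set.mem_insert _ _)
    refine ⟨E.sum F, hE.sum hF, ?_⟩
    exact (Set.insert_subset (Set.mem_union_left _ hpE)
      (hTF.trans Set.subset_union_right)).trans (Supp_union_subset_sum E F)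

end MF

theorem stmt9 (R : Type) [CommRing R] [IsNoetherianRing R] (W : R)
    (hW : W ∈ nonZeroDivisors R)
    (Z : Set (PrimeSpectrum R)) (hZ : IsClosed Z)
    (hsub : ∀ p ∈ Z, ∃ E : MF R, E.IsMF W ∧ p ∈ E.Supp) :
    ∃ F : MF R, F.IsMF W ∧ F.Supp = Z := by
  obtain ⟨I, rfl⟩ := (PrimeSpectrum.isClosed_iff_zeroLocus_ideal Z).1 hZ
  have hfin : {p : PrimeSpectrum R | p.asIdeal ∈ I.minimalPrimes}.Finite :=
    (Ideal.finite_minimalPrimes_of_isNoetherianRing R I).preimage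
      fun p _ q _ hpq => PrimeSpectrum.ext hpq
  obtain ⟨E, hE, hsupp⟩ := MF.exists_subset_Supp_of_finite hfin fun p hp => hsub p hp.1.2
  obtain ⟨s, hs⟩ := IsNoetherian.noetherian I
  obtain ⟨F, hF, e⟩ := MF.exists_Supp_eq_inter_zeroLocus hE s
  refine ⟨F, hF, ?_⟩
  rw [e, ← PrimeSpectrum.zeroLocus_span (s : Set R), Ideal.span, hs,
    Set.inter_eq_right]
  intro q hq
  obtain ⟨p, hp, hpq⟩ := Ideal.exists_minimalPrimes_le (J := q.asIdeal) hq
  exact E.mem_Supp_of_le hpq (hsupp (a := ⟨p, hp.1.1⟩) hp)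
end
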